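/- arXiv:1801.00039 — 2 statements merged into one kernel-verified Lean document; each statement's English description precedes it below -/
import Mathlib

section
/- Let u, v ∈ L¹(ℝ) ∩ L^∞(ℝ) with v differentiable and v' ∈ L¹(ℝ). Then for every real z with |z| > 1 there exist unique bounded continuous functions m̂₊(·;z), m̂₋(·;z), n̂₊(·;z), n̂₋(·;z) : ℝ → ℂ² satisfying, for all x ∈ ℝ, the Volterra integral equations m̂_±(x;z) = e₁ + ∫_{±∞}^{x} diag(1, e^{−(i/2)(z−z⁻¹)(x−y)})·(Q̂₁(u,v)(y) + z⁻¹·Q̂₂(u,v)(y))·m̂_±(y;z) dy and n̂_±(x;z) = e₂ + ∫_{±∞}^{x} diag(e^{(i/2)(z−z⁻¹)(x−y)}, 1)·(Q̂₁(u,v)(y) + z⁻¹·Q̂₂(u,v)(y))·n̂_±(y;z) dy, where e₁ = (1,0)ᵀ and e₂ = (0,1)ᵀ. Moreover, there exists a constant C > 0, depending only on u and v, such that sup_{x∈ℝ} |m̂_±(x;z)| + sup_{x∈ℝ} |n̂_±(x;z)| ≤ C for all real z with |z| > 1. -/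
open Complex Matrix MeasureTheory

noncomputable def Q1h (u v : ℝ → ℂ) (x : ℝ) : Matrix (Fin 2) (Fin 2) ℂ :=
  !![(I / 4) * ((‖u x‖ : ℂ) ^ 2 + (‖v x‖ : ℂ) ^ 2), -(I / 2) * starRingEnd ℂ (v x);
     deriv v x + (I / 2) * (‖u x‖ : ℂ) ^ 2 * v x + (I / 2) * u x,
       -(I / 4) * ((‖u x‖ : ℂ) ^ 2 + (‖v x‖ : ℂ) ^ 2)]

noncomputable def Q2h (u v : ℝ → ℂ) (x : ℝ) : Matrix (Fin 2) (Fin 2) ℂ :=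
  (-(I / 2)) • !![starRingEnd ℂ (u x) * v x, -starRingEnd ℂ (u x);
                  v x + starRingEnd ℂ (u x) * (v x) ^ 2, -(starRingEnd ℂ (u x) * v x)]

/-- the oscillatory kernel e^{−(i/2)(z−z⁻¹)(x−y)} -/
noncomputable def Em (z x y : ℝ) : ℂ :=
  Complex.exp (-(I / 2) * ((z : ℂ) - (z : ℂ)⁻¹) * ((x : ℂ) - (y : ℂ)))

def e1 : Fin 2 → ℂ := ![1, 0]
def e2 : Fin 2 → ℂ := ![0, 1]

def BddCont (f : ℝ → Fin 2 → ℂ) : Prop := Continuous f ∧ ∃ M : ℝ, ∀ x : ℝ, ‖f x‖ ≤ M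

/-- the four Volterra integral equations for m̂₊, m̂₋, n̂₊, n̂₋ -/
def IsSolHat (u v : ℝ → ℂ) (z : ℝ) (mp mm np nm : ℝ → Fin 2 → ℂ) : Prop :=
  BddCont mp ∧ BddCont mm ∧ BddCont np ∧ BddCont nm ∧
  (∀ x : ℝ, mp x = e1 - ∫ y in Set.Ici x,
      (!![1, 0; 0, Em z x y] * (Q1h u v y + ((z : ℂ))⁻¹ • Q2h u v y)).mulVec (mp y)) ∧
  (∀ x : ℝ, mm x = e1 + ∫ y in Set.Iic x,
      (!![1, 0; 0, Em z x y] * (Q1h u v y + ((z : ℂ))⁻¹ • Q2h u v y)).mulVec (mm y)) ∧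
  (∀ x : ℝ, np x = e2 - ∫ y in Set.Ici x,
      (!![Em z y x, 0; 0, 1] * (Q1h u v y + ((z : ℂ))⁻¹ • Q2h u v y)).mulVec (np y)) ∧
  (∀ x : ℝ, nm x = e2 + ∫ y in Set.Iic x,
      (!![Em z y x, 0; 0, 1] * (Q1h u v y + ((z : ℂ))⁻¹ • Q2h u v y)).mulVec (nm y))

open Filter Topology in
/-- An integrable nonnegative density admits a bounded continuous weight whose mass on each left
half-line is at most half of its value at the endpoint. -/
theorem exists_weight_Iic {g : ℝ → ℝ} (hg : Integrable g) :
    ∃ (w : ℝ → ℝ) (W : ℝ), Continuous w ∧ (∀ x, 1 ≤ w x) ∧ (∀ x, w x ≤ W) ∧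
      ∀ x, ∫ y in Set.Iic x, g y * w y ≤ 1 / 2 * w x := by
  obtain ⟨φ, hφc, hφg, hφ, hφi⟩ :=
    hg.exists_hasCompactSupport_integral_sub_le (show (0 : ℝ) < 1 / 4 by norm_num)
  set G : ℝ → ℝ := fun x => ∫ y in Set.Iic x, ‖φ y‖ with hG
  have hG0 : ∀ x, 0 ≤ G x := fun x => integral_nonneg fun _ => norm_nonneg _
  have hGmono : Monotone G := fun a b hab =>
    setIntegral_mono_set hφi.norm.integrableOn (ae_of_all _ fun _ => norm_nonneg _)
      (Set.Iic_subset_Iic.2 hab).eventuallyLE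
  have hGle : ∀ x, G x ≤ ∫ y, ‖φ y‖ := fun x =>
    setIntegral_le_integral hφi.norm (ae_of_all _ fun _ => norm_nonneg _)
  have hGd : ∀ x, HasDerivAt G ‖φ x‖ x := by
    intro x
    have h : G = fun x => G 0 + ∫ y in (0 : ℝ)..x, ‖φ y‖ := by
      funext x
      rw [← intervalIntegral.integral_Iic_sub_Iic hφi.norm.integrableOn hφi.norm.integrableOn]
      simp [hG]
    rw [h]
    exact ((hφ.norm.integral_hasStrictDerivAt 0 x).hasDerivAt).const_add _
  have hGz : ∀ᶠ x in atBot, G x = 0 := by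
    obtain ⟨R, hR⟩ := hφc.isCompact.bddBelow
    filter_upwards [eventually_lt_atBot R] with x hx
    refine setIntegral_eq_zero_of_forall_eq_zero fun y hy => ?_
    rw [norm_eq_zero]
    by_contra h
    exact absurd (hR (subset_tsupport φ h)) (not_le.2 (lt_of_le_of_lt hy hx))
  set w : ℝ → ℝ := fun x => Real.exp (4 * G x) with hw
  have hwd : ∀ x, HasDerivAt (fun x => w x / 4) (‖φ x‖ * w x) x := by
    intro x
    have := (((hGd x).const_mul 4).exp).div_const 4
    exact this.congr_deriv (by ring)
  have hGc : Continuous G := continuous_iff_continuousAt.2 fun x => (hGd x).continuousAt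
  have hwc : Continuous w := Real.continuous_exp.comp (continuous_const.mul hGc)
  have hwpos : ∀ x, 0 < w x := fun x => Real.exp_pos _
  have hwmono : Monotone w := fun a b hab =>
    Real.exp_le_exp.2 (mul_le_mul_of_nonneg_left (hGmono hab) (by norm_num))
  have hwW : ∀ x, w x ≤ Real.exp (4 * ∫ y, ‖φ y‖) := fun x =>
    Real.exp_le_exp.2 (mul_le_mul_of_nonneg_left (hGle x) (by norm_num))
  have hfw : ∀ f : ℝ → ℝ, Integrable f → Integrable fun y => f y * w y := fun f hf =>
    hf.mul_bdd (c := Real.exp (4 * ∫ y, ‖φ y‖)) hwc.aestronglyMeasurable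
      (ae_of_all _ fun x => by rw [Real.norm_of_nonneg (hwpos x).le]; exact hwW x)
  refine ⟨w, _, hwc, fun x => Real.one_le_exp (mul_nonneg (by norm_num) (hG0 x)), hwW, fun x => ?_⟩
  have h1 : ∫ y in Set.Iic x, ‖φ y‖ * w y = w x / 4 - 1 / 4 := by
    refine integral_Iic_of_hasDerivAt_of_tendsto (hwc.div_const 4).continuousWithinAt
      (fun y _ => hwd y) (hfw _ hφi.norm).integrableOn ?_
    refine tendsto_const_nhds.congr' ?_
    filter_upwards [hGz] with y hy
    simp [hw, hy]
  have h2 : ∫ y in Set.Iic x, ‖g y - φ y‖ * w y ≤ 1 / 4 * w x := by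
    calc ∫ y in Set.Iic x, ‖g y - φ y‖ * w y
        ≤ ∫ y in Set.Iic x, ‖g y - φ y‖ * w x := by
          refine setIntegral_mono_on (hfw _ (hg.sub hφi).norm).integrableOn
            ((hg.sub hφi).norm.mul_const _).integrableOn measurableSet_Iic fun y hy => ?_
          exact mul_le_mul_of_nonneg_left (hwmono hy) (norm_nonneg _)
      _ = (∫ y in Set.Iic x, ‖g y - φ y‖) * w x := integral_mul_const _ _
      _ ≤ 1 / 4 * w x := by
          refine mul_le_mul_of_nonneg_right (le_trans ?_ hφg) (hwpos x).le
          exact setIntegral_le_integral (hg.sub hφi).norm (ae_of_all _ fun _ => norm_nonneg _)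
  calc ∫ y in Set.Iic x, g y * w y
      ≤ ∫ y in Set.Iic x, (‖φ y‖ * w y + ‖g y - φ y‖ * w y) := by
        refine integral_mono (hfw _ hg).integrableOn
          ((hfw _ hφi.norm).add (hfw _ (hg.sub hφi).norm)).integrableOn fun y => ?_
        have : g y ≤ ‖φ y‖ + ‖g y - φ y‖ := by
          have h1 := le_abs_self (φ y)
          have h2 := le_abs_self (g y - φ y)
          rw [Real.norm_eq_abs, Real.norm_eq_abs]; linarith
        rw [← add_mul]
        exact mul_le_mul_of_nonneg_right this (hwpos y).le
    _ = (w x / 4 - 1 / 4) + ∫ y in Set.Iic x, ‖g y - φ y‖ * w y := by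
        rw [← h1]
        exact integral_add (hfw _ hφi.norm).integrableOn (hfw _ (hg.sub hφi).norm).integrableOn
    _ ≤ 1 / 2 * w x := by linarith

/-- The mirror image of `exists_weight_Iic` for right half-lines. -/
theorem exists_weight_Ici {g : ℝ → ℝ} (hg : Integrable g) :
    ∃ (w : ℝ → ℝ) (W : ℝ), Continuous w ∧ (∀ x, 1 ≤ w x) ∧ (∀ x, w x ≤ W) ∧
      ∀ x, ∫ y in Set.Ici x, g y * w y ≤ 1 / 2 * w x := by
  obtain ⟨w, W, hc, h1, hW, hi⟩ := exists_weight_Iic hg.comp_neg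
  refine ⟨fun x => w (-x), W, hc.comp continuous_neg, fun x => h1 _, fun x => hW _, fun x => ?_⟩
  rw [integral_Ici_eq_integral_Ioi]
  have := integral_comp_neg_Iic (-x) fun y => g y * w (-y)
  rw [neg_neg] at this
  rw [← this]
  simpa using hi (-x)

/-- A linear Volterra kernel on the moving domains `s x`, dominated by an integrable density `g`,
with a bounded weight `w` for which the associated integral operator is a contraction. -/
structure WeightedVolterraKernel {E : Type*} [NormedAddCommGroup E] [NormedSpace ℝ E]
    (s : ℝ → Set ℝ) (K : ℝ → ℝ → E →ₗ[ℝ] E) (g w : ℝ → ℝ) (W : ℝ) : Prop where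
  measurableSet : ∀ x, MeasurableSet (s x)
  eventually_mem_iff : ∀ x, ∀ᵐ y, ∀ᶠ t in nhds x, (y ∈ s t ↔ y ∈ s x)
  aestronglyMeasurable : ∀ x (f : ℝ → E), Continuous f →
    AEStronglyMeasurable (fun y => K x y (f y)) volume
  continuous_left : ∀ y a, Continuous fun x => K x y a
  norm_le : ∀ x y a, ‖K x y a‖ ≤ g y * ‖a‖
  integrable : Integrable g
  nonneg : ∀ y, 0 ≤ g y
  continuous_weight : Continuous w
  one_le_weight : ∀ x, 1 ≤ w x
  weight_le : ∀ x, w x ≤ W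
  integral_weight_le : ∀ x, ∫ y in s x, g y * w y ≤ 1 / 2 * w x

namespace WeightedVolterraKernel

variable {E : Type*} [NormedAddCommGroup E] [NormedSpace ℝ E]
  {s : ℝ → Set ℝ} {K : ℝ → ℝ → E →ₗ[ℝ] E} {g w : ℝ → ℝ} {W : ℝ}

theorem weight_pos (h : WeightedVolterraKernel s K g w W) (x : ℝ) : 0 < w x :=
  zero_lt_one.trans_le (h.one_le_weight x)

theorem integrable_apply (h : WeightedVolterraKernel s K g w W) {f : ℝ → E} (hf : Continuous f)
    {M : ℝ} (hM : ∀ x, ‖f x‖ ≤ M) (x : ℝ) : Integrable fun y => K x y (f y) :=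
  (h.integrable.mul_const M).mono' (h.aestronglyMeasurable x f hf) <| ae_of_all _ fun y =>
    (h.norm_le x y _).trans (mul_le_mul_of_nonneg_left (hM y) (h.nonneg y))

theorem continuous_integral (h : WeightedVolterraKernel s K g w W) {f : ℝ → E} (hf : Continuous f)
    {M : ℝ} (hM : ∀ x, ‖f x‖ ≤ M) : Continuous fun x => ∫ y in s x, K x y (f y) := by
  have hind : (fun x => ∫ y in s x, K x y (f y)) =
      fun x => ∫ y, (s x).indicator (fun y => K x y (f y)) y := by
    funext x
    rw [integral_indicator (h.measurableSet x)]
  rw [hind, continuous_iff_continuousAt]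
  intro x
  refine continuousAt_of_dominated (bound := fun y => g y * M) (Filter.Eventually.of_forall
    fun t => (h.aestronglyMeasurable t f hf).indicator (h.measurableSet t))
    (Filter.Eventually.of_forall fun t => ae_of_all _ fun y => ?_) (h.integrable.mul_const M) ?_
  · exact (norm_indicator_le_norm_self _ _).trans
      ((h.norm_le t y _).trans (mul_le_mul_of_nonneg_left (hM y) (h.nonneg y)))
  · filter_upwards [h.eventually_mem_iff x] with y hy
    by_cases hyx : y ∈ s x
    · refine (h.continuous_left y (f y)).continuousAt.congr ?_
      filter_upwards [hy] with t ht
      exact (Set.indicator_of_mem (ht.2 hyx) fun y => K t y (f y)).symm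
    · refine (continuousAt_const (y := (0 : E))).congr ?_
      filter_upwards [hy] with t ht
      exact (Set.indicator_of_notMem (fun hc => hyx (ht.1 hc)) fun y => K t y (f y)).symm

theorem norm_integral_le (h : WeightedVolterraKernel s K g w W) {f : ℝ → E} {N : ℝ}
    (hN : ∀ x, ‖f x‖ ≤ N * w x) (x : ℝ) : ‖∫ y in s x, K x y (f y)‖ ≤ N * (1 / 2 * w x) := by
  have hN0 : 0 ≤ N := by
    have := (norm_nonneg _).trans (hN 0)
    exact nonneg_of_mul_nonneg_left this (h.weight_pos 0)
  have hfw : Integrable fun y => g y * w y :=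
    h.integrable.mul_bdd (c := W) h.continuous_weight.aestronglyMeasurable
      (ae_of_all _ fun x => by rw [Real.norm_of_nonneg (h.weight_pos x).le]; exact h.weight_le x)
  calc ‖∫ y in s x, K x y (f y)‖ ≤ ∫ y in s x, N * (g y * w y) := by
        refine norm_integral_le_of_norm_le (hfw.const_mul N).integrableOn (ae_of_all _ fun y => ?_)
        calc ‖K x y (f y)‖ ≤ g y * ‖f y‖ := h.norm_le x y _
          _ ≤ g y * (N * w y) := mul_le_mul_of_nonneg_left (hN y) (h.nonneg y)
          _ = N * (g y * w y) := by ring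
    _ = N * ∫ y in s x, g y * w y := integral_const_mul _ _
    _ ≤ N * (1 / 2 * w x) := mul_le_mul_of_nonneg_left (h.integral_weight_le x) hN0

theorem norm_solution_le (h : WeightedVolterraKernel s K g w W) {e : E} {f : ℝ → E} {M : ℝ}
    (hM : ∀ x, ‖f x‖ ≤ M) (hf : ∀ x, f x = e + ∫ y in s x, K x y (f y)) (x : ℝ) :
    ‖f x‖ ≤ 2 * ‖e‖ * W := by
  have hbdd : BddAbove (Set.range fun x => ‖f x‖ / w x) := by
    refine ⟨M, ?_⟩
    rintro _ ⟨y, rfl⟩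
    exact (div_le_self (norm_nonneg _) (h.one_le_weight y)).trans (hM y)
  set N := ⨆ x, ‖f x‖ / w x with hN
  have hfN : ∀ y, ‖f y‖ ≤ N * w y := fun y =>
    (div_le_iff₀ (h.weight_pos y)).1 (le_ciSup hbdd y)
  have hle : N ≤ ‖e‖ + N * (1 / 2) := by
    refine ciSup_le fun y => (div_le_iff₀ (h.weight_pos y)).2 ?_
    rw [hf y]
    have h1 := norm_add_le e (∫ t in s y, K y t (f t))
    have h2 := h.norm_integral_le hfN y
    have h3 := le_mul_of_one_le_right (norm_nonneg e) (h.one_le_weight y)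
    linarith
  calc ‖f x‖ ≤ N * w x := hfN x
    _ ≤ 2 * ‖e‖ * w x := mul_le_mul_of_nonneg_right (by linarith) (h.weight_pos x).le
    _ ≤ 2 * ‖e‖ * W := mul_le_mul_of_nonneg_left (h.weight_le x) (by positivity)

theorem solution_unique (h : WeightedVolterraKernel s K g w W) {e : E} {f₁ f₂ : ℝ → E} {M₁ M₂ : ℝ}
    (hc₁ : Continuous f₁) (hc₂ : Continuous f₂)
    (hM₁ : ∀ x, ‖f₁ x‖ ≤ M₁) (hM₂ : ∀ x, ‖f₂ x‖ ≤ M₂)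
    (hf₁ : ∀ x, f₁ x = e + ∫ y in s x, K x y (f₁ y))
    (hf₂ : ∀ x, f₂ x = e + ∫ y in s x, K x y (f₂ y)) : f₁ = f₂ := by
  funext x
  have hsub : ∀ x, f₁ x - f₂ x = 0 + ∫ y in s x, K x y (f₁ y - f₂ y) := by
    intro x
    simp only [map_sub]
    rw [integral_sub (h.integrable_apply hc₁ hM₁ x).integrableOn
      (h.integrable_apply hc₂ hM₂ x).integrableOn, hf₁ x, hf₂ x]
    abel
  have := h.norm_solution_le (f := fun x => f₁ x - f₂ x) (M := M₁ + M₂)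
    (fun x => (norm_sub_le _ _).trans (add_le_add (hM₁ x) (hM₂ x))) hsub x
  simpa [sub_eq_zero] using this

open scoped BoundedContinuousFunction in
theorem exists_solution [CompleteSpace E] (h : WeightedVolterraKernel s K g w W) (e : E) :
    ∃ f : ℝ → E, Continuous f ∧ (∃ M, ∀ x, ‖f x‖ ≤ M) ∧
      ∀ x, f x = e + ∫ y in s x, K x y (f y) := by
  have hwc := h.continuous_weight
  have hwh : ∀ (b : ℝ →ᵇ E) x, ‖w x • b x‖ ≤ ‖b‖ * w x := fun b x => by
    rw [norm_smul, Real.norm_of_nonneg (h.weight_pos x).le, mul_comm]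
    exact mul_le_mul_of_nonneg_right (b.norm_coe_le_norm x) (h.weight_pos x).le
  have hwhW : ∀ (b : ℝ →ᵇ E) x, ‖w x • b x‖ ≤ ‖b‖ * W := fun b x =>
    (hwh b x).trans (mul_le_mul_of_nonneg_left (h.weight_le x) (norm_nonneg _))
  have hwhc : ∀ b : ℝ →ᵇ E, Continuous fun x => w x • b x := fun b => hwc.smul b.continuous
  let T : (ℝ →ᵇ E) → (ℝ →ᵇ E) := fun b =>
    BoundedContinuousFunction.ofNormedAddCommGroup
      (fun x => (w x)⁻¹ • (e + ∫ y in s x, K x y (w y • b y)))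
      ((hwc.inv₀ fun x => (h.weight_pos x).ne').smul
        (continuous_const.add (h.continuous_integral (hwhc b) (hwhW b))))
      (‖e‖ + ‖b‖ * (1 / 2)) fun x => by
        rw [norm_smul, norm_inv, Real.norm_of_nonneg (h.weight_pos x).le,
          inv_mul_le_iff₀ (h.weight_pos x)]
        have h1 := norm_add_le e (∫ y in s x, K x y (w y • b y))
        have h2 := h.norm_integral_le (hwh b) x
        have h3 := le_mul_of_one_le_right (norm_nonneg e) (h.one_le_weight x)
        linarith
  have hT : ContractingWith (1 / 2) T := by
    refine ⟨by norm_num [← NNReal.coe_lt_coe], LipschitzWith.of_dist_le_mul fun b c => ?_⟩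
    refine (BoundedContinuousFunction.dist_le (by positivity)).2 fun x => ?_
    have hsub : T b x - T c x = (w x)⁻¹ • ∫ y in s x, K x y (w y • (b - c) y) := by
      simp only [T, BoundedContinuousFunction.coe_ofNormedAddCommGroup,
        BoundedContinuousFunction.coe_sub, Pi.sub_apply, smul_sub, map_sub]
      rw [integral_sub (h.integrable_apply (hwhc b) (hwhW b) x).integrableOn
        (h.integrable_apply (hwhc c) (hwhW c) x).integrableOn, ← smul_sub]
      congr 1
      abel
    rw [dist_eq_norm, hsub, norm_smul, norm_inv, Real.norm_of_nonneg (h.weight_pos x).le,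
      inv_mul_le_iff₀ (h.weight_pos x), dist_eq_norm]
    refine (h.norm_integral_le (hwh (b - c)) x).trans (le_of_eq ?_)
    push_cast
    ring
  obtain ⟨b, hb⟩ : ∃ b, T b = b := ⟨_, hT.fixedPoint_isFixedPt⟩
  refine ⟨fun x => w x • b x, hwhc b, ⟨_, hwhW b⟩, fun x => ?_⟩
  have hx : (w x)⁻¹ • (e + ∫ y in s x, K x y (w y • b y)) = b x := DFunLike.congr_fun hb x
  change w x • b x = _
  rw [← hx, smul_inv_smul₀ (h.weight_pos x).ne']

end WeightedVolterraKernel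

/-- A common integrable majorant for the entries of the potential matrices. -/
noncomputable def potentialMajorant (u v : ℝ → ℂ) (y : ℝ) : ℝ :=
  ∑ i, ∑ j, (‖Q1h u v y i j‖ + ‖Q2h u v y i j‖)

theorem potentialMajorant_nonneg (u v : ℝ → ℂ) (y : ℝ) : 0 ≤ potentialMajorant u v y :=
  Finset.sum_nonneg fun _ _ => Finset.sum_nonneg fun _ _ => by positivity

theorem integrable_Q1h {u v : ℝ → ℂ} (hu1 : Integrable u) (hv1 : Integrable v)
    (huB : ∃ M : ℝ, ∀ x : ℝ, ‖u x‖ ≤ M) (hvB : ∃ M : ℝ, ∀ x : ℝ, ‖v x‖ ≤ M)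
    (hv'1 : Integrable (deriv v)) (i j : Fin 2) :
    Integrable fun y => Q1h u v y i j := by
  obtain ⟨A, hA⟩ := huB
  obtain ⟨B, hB⟩ := hvB
  have hu2 : Integrable fun x => (‖u x‖ : ℂ) ^ 2 := by
    simp_rw [sq]
    exact hu1.norm.ofReal.bdd_mul (c := A) hu1.norm.ofReal.aestronglyMeasurable
      (ae_of_all _ fun x => by simpa using hA x)
  have hv2 : Integrable fun x => (‖v x‖ : ℂ) ^ 2 := by
    simp_rw [sq]
    exact hv1.norm.ofReal.bdd_mul (c := B) hv1.norm.ofReal.aestronglyMeasurable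
      (ae_of_all _ fun x => by simpa using hB x)
  have hdiag : Integrable fun x => (‖u x‖ : ℂ) ^ 2 + (‖v x‖ : ℂ) ^ 2 := hu2.add hv2
  have huuv : Integrable fun x => (I / 2) * (‖u x‖ : ℂ) ^ 2 * v x :=
    (hu2.const_mul (I / 2)).mul_bdd (c := B) hv1.aestronglyMeasurable (ae_of_all _ hB)
  have hvc : Integrable fun x => starRingEnd ℂ (v x) :=
    hv1.mono (Complex.continuous_conj.comp_aestronglyMeasurable hv1.aestronglyMeasurable)
      (ae_of_all _ fun x => by simp)
  fin_cases i <;> fin_cases j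
  · exact hdiag.const_mul _
  · exact hvc.const_mul _
  · exact (hv'1.add huuv).add (hu1.const_mul _)
  · exact hdiag.const_mul _

theorem integrable_Q2h {u v : ℝ → ℂ} (hu1 : Integrable u) (hv1 : Integrable v)
    (huB : ∃ M : ℝ, ∀ x : ℝ, ‖u x‖ ≤ M) (hvB : ∃ M : ℝ, ∀ x : ℝ, ‖v x‖ ≤ M)
    (i j : Fin 2) : Integrable fun y => Q2h u v y i j := by
  obtain ⟨A, hA⟩ := huB
  obtain ⟨B, hB⟩ := hvB
  have huc : Integrable fun x => starRingEnd ℂ (u x) :=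
    hu1.mono (Complex.continuous_conj.comp_aestronglyMeasurable hu1.aestronglyMeasurable)
      (ae_of_all _ fun x => by simp)
  have huv : Integrable fun x => starRingEnd ℂ (u x) * v x :=
    huc.mul_bdd (c := B) hv1.aestronglyMeasurable (ae_of_all _ hB)
  have huvv : Integrable fun x => starRingEnd ℂ (u x) * (v x) ^ 2 := by
    simp_rw [sq, ← mul_assoc]
    exact huv.mul_bdd (c := B) hv1.aestronglyMeasurable (ae_of_all _ hB)
  fin_cases i <;> fin_cases j
  · exact huv.const_mul _
  · exact huc.neg.const_mul _
  · exact (hv1.add huvv).const_mul _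
  · exact huv.neg.const_mul _

theorem integrable_potentialMajorant {u v : ℝ → ℂ} (hu1 : Integrable u) (hv1 : Integrable v)
    (huB : ∃ M : ℝ, ∀ x : ℝ, ‖u x‖ ≤ M) (hvB : ∃ M : ℝ, ∀ x : ℝ, ‖v x‖ ≤ M)
    (hv'1 : Integrable (deriv v)) :
    Integrable (potentialMajorant u v) :=
  integrable_finsetSum _ fun i _ => integrable_finsetSum _ fun j _ =>
    (integrable_Q1h hu1 hv1 huB hvB hv'1 i j).norm.add (integrable_Q2h hu1 hv1 huB hvB i j).norm

/-- The kernel `diag(p, q) (Q₁ + z⁻¹ Q₂)`. -/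
noncomputable def potentialKernel (u v : ℝ → ℂ) (z : ℝ) (p q : ℝ → ℝ → ℂ) (x y : ℝ) :
    Matrix (Fin 2) (Fin 2) ℂ :=
  !![p x y, 0; 0, q x y] * (Q1h u v y + ((z : ℂ))⁻¹ • Q2h u v y)

theorem potentialKernel_mulVec_apply (u v : ℝ → ℂ) (z : ℝ) (p q : ℝ → ℝ → ℂ) (x y : ℝ)
    (a : Fin 2 → ℂ) (i : Fin 2) :
    (potentialKernel u v z p q x y).mulVec a i =
      ![p x y, q x y] i * ∑ j, (Q1h u v y i j + (z : ℂ)⁻¹ * Q2h u v y i j) * a j := by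
  fin_cases i <;>
    simp [potentialKernel, Matrix.mulVec, dotProduct, Matrix.mul_apply, Fin.sum_univ_two] <;> ring

theorem norm_potentialKernel_mulVec_le {u v : ℝ → ℂ} {z : ℝ} (hz : 1 < |z|) {p q : ℝ → ℝ → ℂ}
    (hp : ∀ x y, ‖p x y‖ = 1) (hq : ∀ x y, ‖q x y‖ = 1) (x y : ℝ) (a : Fin 2 → ℂ) :
    ‖(potentialKernel u v z p q x y).mulVec a‖ ≤ potentialMajorant u v y * ‖a‖ := by
  have hzi : ‖(z : ℂ)⁻¹‖ ≤ 1 := by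
    rw [norm_inv, Complex.norm_real, Real.norm_eq_abs]
    exact inv_le_one_of_one_le₀ hz.le
  refine (pi_norm_le_iff_of_nonneg
    (mul_nonneg (potentialMajorant_nonneg u v y) (norm_nonneg a))).2 fun i => ?_
  rw [potentialKernel_mulVec_apply, norm_mul]
  have hd : ‖(![p x y, q x y] : Fin 2 → ℂ) i‖ = 1 := by
    fin_cases i
    · exact hp x y
    · exact hq x y
  rw [hd, one_mul]
  calc ‖∑ j, (Q1h u v y i j + (z : ℂ)⁻¹ * Q2h u v y i j) * a j‖
      ≤ ∑ j, ‖(Q1h u v y i j + (z : ℂ)⁻¹ * Q2h u v y i j) * a j‖ := norm_sum_le _ _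
    _ ≤ ∑ j, (‖Q1h u v y i j‖ + ‖Q2h u v y i j‖) * ‖a‖ := by
        refine Finset.sum_le_sum fun j _ => ?_
        rw [norm_mul]
        refine mul_le_mul ((norm_add_le _ _).trans ?_) (norm_le_pi_norm a j) (norm_nonneg _)
          (by positivity)
        rw [norm_mul]
        exact add_le_add le_rfl (mul_le_of_le_one_left (norm_nonneg _) hzi)
    _ = (∑ j, (‖Q1h u v y i j‖ + ‖Q2h u v y i j‖)) * ‖a‖ := (Finset.sum_mul _ _ _).symm
    _ ≤ potentialMajorant u v y * ‖a‖ := by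
        refine mul_le_mul_of_nonneg_right ?_ (norm_nonneg a)
        exact Finset.single_le_sum
          (f := fun i => ∑ j, (‖Q1h u v y i j‖ + ‖Q2h u v y i j‖))
          (fun _ _ => Finset.sum_nonneg fun _ _ => by positivity) (Finset.mem_univ i)

theorem norm_Em (z x y : ℝ) : ‖Em z x y‖ = 1 := by
  have : Em z x y = Complex.exp (((-(1 / 2) * (z - z⁻¹) * (x - y) : ℝ) : ℂ) * I) := by
    rw [Em]
    congr 1
    push_cast
    ring
  rw [this, Complex.norm_exp_ofReal_mul_I]

theorem continuous_Em_left (z y : ℝ) : Continuous fun x => Em z x y := by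
  unfold Em
  fun_prop

theorem continuous_Em_right (z x : ℝ) : Continuous fun y => Em z x y := by
  unfold Em
  fun_prop

theorem potentialKernel_weightedVolterraKernel {u v : ℝ → ℂ}
    (hQ1 : ∀ i j, Integrable fun y => Q1h u v y i j)
    (hQ2 : ∀ i j, Integrable fun y => Q2h u v y i j)
    {s : ℝ → Set ℝ} (hs : ∀ x, MeasurableSet (s x))
    (hsm : ∀ x, ∀ᵐ y, ∀ᶠ t in nhds x, (y ∈ s t ↔ y ∈ s x))
    {w : ℝ → ℝ} {W : ℝ} (hg : Integrable (potentialMajorant u v)) (hwc : Continuous w)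
    (hw1 : ∀ x, 1 ≤ w x) (hwW : ∀ x, w x ≤ W)
    (hwi : ∀ x, ∫ y in s x, potentialMajorant u v y * w y ≤ 1 / 2 * w x)
    {z : ℝ} (hz : 1 < |z|) {p q : ℝ → ℝ → ℂ}
    (hp : ∀ x y, ‖p x y‖ = 1) (hq : ∀ x y, ‖q x y‖ = 1)
    (hpl : ∀ y, Continuous fun x => p x y) (hql : ∀ y, Continuous fun x => q x y)
    (hpr : ∀ x, Continuous fun y => p x y) (hqr : ∀ x, Continuous fun y => q x y)
    (c : ℝ) (hc : |c| = 1) :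
    WeightedVolterraKernel s
      (fun x y => c • ((potentialKernel u v z p q x y).mulVecLin).restrictScalars ℝ)
      (potentialMajorant u v) w W where
  measurableSet := hs
  eventually_mem_iff := hsm
  aestronglyMeasurable x f hf := by
    refine AEStronglyMeasurable.const_smul ?_ c
    refine (aemeasurable_pi_iff.2 fun i => ?_).aestronglyMeasurable
    simp only [LinearMap.restrictScalars_apply, Matrix.mulVecLin_apply,
      potentialKernel_mulVec_apply]
    have hd : Continuous fun y => (![p x y, q x y] : Fin 2 → ℂ) i := by
      fin_cases i
      · exact hpr x
      · exact hqr x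
    refine hd.aemeasurable.mul (Finset.aemeasurable_fun_sum _ fun j _ => ?_)
    exact ((hQ1 i j).aemeasurable.add ((hQ2 i j).aemeasurable.const_mul _)).mul
      ((continuous_apply j).comp hf).aemeasurable
  continuous_left y a := by
    refine Continuous.const_smul ?_ c
    refine continuous_pi fun i => ?_
    simp only [LinearMap.restrictScalars_apply, Matrix.mulVecLin_apply,
      potentialKernel_mulVec_apply]
    refine Continuous.mul ?_ continuous_const
    fin_cases i
    · exact hpl y
    · exact hql y
  norm_le x y a := by
    rw [LinearMap.smul_apply, norm_smul, Real.norm_eq_abs, hc, one_mul]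
    exact norm_potentialKernel_mulVec_le hz hp hq x y a
  integrable := hg
  nonneg := potentialMajorant_nonneg u v
  continuous_weight := hwc
  one_le_weight := hw1
  weight_le := hwW
  integral_weight_le := hwi

theorem WeightedVolterraKernel.existsUnique_bddCont {s : ℝ → Set ℝ}
    {K : ℝ → ℝ → (Fin 2 → ℂ) →ₗ[ℝ] (Fin 2 → ℂ)} {g w : ℝ → ℝ} {W : ℝ}
    (h : WeightedVolterraKernel s K g w W) (e : Fin 2 → ℂ) :
    ∃! f : ℝ → Fin 2 → ℂ, BddCont f ∧ ∀ x, f x = e + ∫ y in s x, K x y (f y) := by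
  obtain ⟨f, hfc, hfb, hf⟩ := h.exists_solution e
  refine ⟨f, ⟨⟨hfc, hfb⟩, hf⟩, ?_⟩
  rintro f' ⟨⟨hfc', M', hM'⟩, hf'⟩
  obtain ⟨M, hM⟩ := hfb
  exact h.solution_unique hfc' hfc hM' hM hf' hf

theorem eventually_mem_Iic_iff (x : ℝ) :
    ∀ᵐ y : ℝ, ∀ᶠ t in nhds x, (y ∈ Set.Iic t ↔ y ∈ Set.Iic x) := by
  filter_upwards [Measure.ae_ne volume x] with y hy
  rcases lt_or_gt_of_ne hy with h | h
  · filter_upwards [lt_mem_nhds h] with t ht using iff_of_true ht.le h.le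
  · filter_upwards [gt_mem_nhds h] with t ht using iff_of_false ht.not_ge h.not_ge

theorem eventually_mem_Ici_iff (x : ℝ) :
    ∀ᵐ y : ℝ, ∀ᶠ t in nhds x, (y ∈ Set.Ici t ↔ y ∈ Set.Ici x) := by
  filter_upwards [Measure.ae_ne volume x] with y hy
  rcases lt_or_gt_of_ne hy with h | h
  · filter_upwards [lt_mem_nhds h] with t ht using iff_of_false ht.not_ge h.not_ge
  · filter_upwards [gt_mem_nhds h] with t ht using iff_of_true ht.le h.le

theorem norm_e1 : ‖e1‖ = 1 := by
  simp [e1, Pi.norm_def, Fin.univ_succ]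

theorem norm_e2 : ‖e2‖ = 1 := by
  simp [e2, Pi.norm_def, Fin.univ_succ]

/-- Each of the four equations, with a bound on its solutions that is uniform in `z`. -/
theorem exists_bound_and_existsUnique (u v : ℝ → ℂ)
    (hu1 : Integrable u) (hv1 : Integrable v)
    (huB : ∃ M : ℝ, ∀ x : ℝ, ‖u x‖ ≤ M) (hvB : ∃ M : ℝ, ∀ x : ℝ, ‖v x‖ ≤ M)
    (hv'1 : Integrable (deriv v)) :
    ∃ C : ℝ, 0 < C ∧ ∀ z : ℝ, 1 < |z| → ∀ p q : ℝ → ℝ → ℂ,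
      (∀ x y, ‖p x y‖ = 1) → (∀ x y, ‖q x y‖ = 1) →
      (∀ y, Continuous fun x => p x y) → (∀ y, Continuous fun x => q x y) →
      (∀ x, Continuous fun y => p x y) → (∀ x, Continuous fun y => q x y) →
      ∀ e : Fin 2 → ℂ, ‖e‖ = 1 →
      ((∃! f : ℝ → Fin 2 → ℂ, BddCont f ∧
          ∀ x, f x = e - ∫ y in Set.Ici x, (potentialKernel u v z p q x y).mulVec (f y)) ∧
        (∃! f : ℝ → Fin 2 → ℂ, BddCont f ∧
          ∀ x, f x = e + ∫ y in Set.Iic x, (potentialKernel u v z p q x y).mulVec (f y))) ∧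
      ((∀ f : ℝ → Fin 2 → ℂ, BddCont f →
          (∀ x, f x = e - ∫ y in Set.Ici x, (potentialKernel u v z p q x y).mulVec (f y)) →
          ∀ x, ‖f x‖ ≤ C) ∧
        (∀ f : ℝ → Fin 2 → ℂ, BddCont f →
          (∀ x, f x = e + ∫ y in Set.Iic x, (potentialKernel u v z p q x y).mulVec (f y)) →
          ∀ x, ‖f x‖ ≤ C)) := by
  have hQ1 := integrable_Q1h hu1 hv1 huB hvB hv'1
  have hQ2 := integrable_Q2h hu1 hv1 huB hvB
  have hg := integrable_potentialMajorant hu1 hv1 huB hvB hv'1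
  obtain ⟨w, W, hwc, hw1, hwW, hwi⟩ := exists_weight_Iic hg
  obtain ⟨w', W', hwc', hw1', hwW', hwi'⟩ := exists_weight_Ici hg
  have hW : 1 ≤ W := (hw1 0).trans (hwW 0)
  have hW' : 1 ≤ W' := (hw1' 0).trans (hwW' 0)
  refine ⟨2 * (W + W'), by linarith, fun z hz p q hp hq hpl hql hpr hqr e he => ?_⟩
  have hm := potentialKernel_weightedVolterraKernel hQ1 hQ2 (fun _ => measurableSet_Iic)
    eventually_mem_Iic_iff hg hwc hw1 hwW hwi hz hp hq hpl hql hpr hqr 1 abs_one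
  have hpk := potentialKernel_weightedVolterraKernel hQ1 hQ2 (fun _ => measurableSet_Ici)
    eventually_mem_Ici_iff hg hwc' hw1' hwW' hwi' hz hp hq hpl hql hpr hqr (-1) (by simp)
  have hm1 := hm.existsUnique_bddCont e
  have hp1 := hpk.existsUnique_bddCont e
  have hm2 := fun f M hM hf => hm.norm_solution_le (e := e) (f := f) (M := M) hM hf
  have hp2 := fun f M hM hf => hpk.norm_solution_le (e := e) (f := f) (M := M) hM hf
  simp only [LinearMap.smul_apply, LinearMap.restrictScalars_apply, Matrix.mulVecLin_apply,
    one_smul, neg_smul, integral_neg, ← sub_eq_add_neg, he] at hm1 hp1 hm2 hp2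
  refine ⟨⟨hp1, hm1⟩, ?_, ?_⟩
  · rintro f ⟨-, M, hM⟩ hf x
    have := hp2 f M hM hf x
    linarith
  · rintro f ⟨-, M, hM⟩ hf x
    have := hm2 f M hM hf x
    linarith

/-- Existence, uniqueness and uniform boundedness of the transformed Jost functions
for |z| > 1. -/
theorem jost_existence_large_z (u v : ℝ → ℂ)
    (hu1 : Integrable u) (hv1 : Integrable v)
    (huB : ∃ M : ℝ, ∀ x : ℝ, ‖u x‖ ≤ M) (hvB : ∃ M : ℝ, ∀ x : ℝ, ‖v x‖ ≤ M)
    (hvd : Differentiable ℝ v) (hv'1 : Integrable (deriv v)) :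
    (∀ z : ℝ, 1 < |z| →
      ∃! F : (ℝ → Fin 2 → ℂ) × (ℝ → Fin 2 → ℂ) × (ℝ → Fin 2 → ℂ) × (ℝ → Fin 2 → ℂ),
        IsSolHat u v z F.1 F.2.1 F.2.2.1 F.2.2.2) ∧
    (∃ C : ℝ, 0 < C ∧ ∀ z : ℝ, 1 < |z| →
      ∀ mp mm np nm : ℝ → Fin 2 → ℂ, IsSolHat u v z mp mm np nm →
        ∀ x y : ℝ, ‖mp x‖ + ‖np y‖ ≤ C ∧ ‖mm x‖ + ‖nm y‖ ≤ C) := by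
  obtain ⟨C, hC, h⟩ := exists_bound_and_existsUnique u v hu1 hv1 huB hvB hv'1
  have hone : ∀ x y : ℝ, ‖(fun _ _ => 1 : ℝ → ℝ → ℂ) x y‖ = 1 := fun _ _ => norm_one
  have hm := fun z hz => h z hz (fun _ _ => 1) (Em z) hone (norm_Em z)
    (fun _ => continuous_const) (continuous_Em_left z) (fun _ => continuous_const)
    (continuous_Em_right z) e1 norm_e1
  have hn := fun z hz => h z hz (fun x y => Em z y x) (fun _ _ => 1) (fun x y => norm_Em z y x)
    hone (continuous_Em_right z) (fun _ => continuous_const) (continuous_Em_left z)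
    (fun _ => continuous_const) e2 norm_e2
  refine ⟨fun z hz => ?_, 2 * C, by linarith, ?_⟩
  · obtain ⟨⟨mp, ⟨hmp, hmp'⟩, ump⟩, ⟨mm, ⟨hmm, hmm'⟩, umm⟩⟩ := (hm z hz).1
    obtain ⟨⟨np, ⟨hnp, hnp'⟩, unp⟩, ⟨nm, ⟨hnm, hnm'⟩, unm⟩⟩ := (hn z hz).1
    refine ⟨(mp, mm, np, nm), ⟨hmp, hmm, hnp, hnm, hmp', hmm', hnp', hnm'⟩, ?_⟩
    rintro ⟨a, b, c, d⟩ ⟨ha, hb, hc, hd, ha', hb', hc', hd'⟩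
    simp only [Prod.mk.injEq]
    exact ⟨ump a ⟨ha, ha'⟩, umm b ⟨hb, hb'⟩, unp c ⟨hc, hc'⟩, unm d ⟨hd, hd'⟩⟩
  · rintro z hz mp mm np nm ⟨ha, hb, hc, hd, ha', hb', hc', hd'⟩ x y
    have h1 := (hm z hz).2.1 mp ha ha' x
    have h2 := (hm z hz).2.2 mm hb hb' x
    have h3 := (hn z hz).2.1 np hc hc' y
    have h4 := (hn z hz).2.2 nm hd hd' y
    exact ⟨by linarith, by linarith⟩
end

section
/- Let f : ℝ → ℂ be continuously differentiable such that f ∈ L²(ℝ), f' ∈ L²(ℝ), and the function x ↦ x·f(x) belongs to L²(ℝ). Then for every z ∈ ℝ, |z|·|f(z)|² ≤ ‖f‖²_{L²(ℝ)} + 2·‖x·f(x)‖_{L²(ℝ)}·‖f'‖_{L²(ℝ)}. In particular the function z ↦ z·f(z)² is bounded on ℝ. -/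
open MeasureTheory

/-- The **Cauchy–Schwarz inequality** for integrals of norms. -/
theorem integral_norm_mul_norm_le_sqrt_mul_sqrt {α E F : Type*} [MeasurableSpace α]
    {μ : Measure α} [NormedAddCommGroup E] [NormedAddCommGroup F] {g : α → E} {h : α → F}
    (hg : MemLp g 2 μ) (hh : MemLp h 2 μ) :
    ∫ x, ‖g x‖ * ‖h x‖ ∂μ ≤ √(∫ x, ‖g x‖ ^ 2 ∂μ) * √(∫ x, ‖h x‖ ^ 2 ∂μ) := by
  have key := integral_mul_norm_le_Lp_mul_Lq (μ := μ) Real.HolderConjugate.two_two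
    (f := fun x => ‖g x‖) (g := fun x => ‖h x‖) (by simpa using hg.norm) (by simpa using hh.norm)
  simpa only [norm_norm, Real.sqrt_eq_rpow, Real.rpow_two] using key

/-- Integrating the derivative of `s ↦ s * f s ^ 2` from the origin. -/
theorem integral_sq_add_two_mul_mul_deriv {f : ℝ → ℂ} (hf : ContDiff ℝ 1 f) (z : ℝ) :
    ∫ s in (0 : ℝ)..z, (f s ^ 2 + 2 * (s * f s) * deriv f s) = z * f z ^ 2 := by
  have hcont : Continuous fun s : ℝ => f s ^ 2 + 2 * (s * f s) * deriv f s := by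
    have := hf.continuous
    have := hf.continuous_deriv le_rfl
    fun_prop
  have hderiv (s : ℝ) : HasDerivAt (fun s : ℝ => (s : ℂ) * f s ^ 2)
      (f s ^ 2 + 2 * (s * f s) * deriv f s) s := by
    have hfs : HasDerivAt f (deriv f s) s := (hf.differentiable one_ne_zero s).hasDerivAt
    refine ((Complex.ofRealCLM.hasDerivAt (x := s)).mul (hfs.pow 2)).congr_deriv ?_
    simp
    ring
  rw [intervalIntegral.integral_eq_sub_of_hasDerivAt (fun s _ => hderiv s)
    (hcont.intervalIntegrable _ _)]
  simp

/-- If f ∈ L²(ℝ) is C¹ with f' ∈ L²(ℝ) and x·f(x) ∈ L²(ℝ), then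
|z||f(z)|² ≤ ‖f‖² + 2‖xf‖·‖f'‖, so z·f(z)² is bounded on ℝ. -/
theorem pointwise_weighted_bound_of_weighted_function (f : ℝ → ℂ)
    (hf : ContDiff ℝ 1 f)
    (hf2 : Integrable (fun x : ℝ => ‖f x‖ ^ 2))
    (hf'2 : Integrable (fun x : ℝ => ‖deriv f x‖ ^ 2))
    (hxf : Integrable (fun x : ℝ => ‖(x : ℂ) * f x‖ ^ 2)) :
    (∀ z : ℝ, |z| * ‖f z‖ ^ 2 ≤ (∫ x : ℝ, ‖f x‖ ^ 2)
        + 2 * Real.sqrt (∫ x : ℝ, ‖(x : ℂ) * f x‖ ^ 2)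
            * Real.sqrt (∫ x : ℝ, ‖deriv f x‖ ^ 2)) ∧
    (∃ M : ℝ, ∀ z : ℝ, ‖(z : ℂ) * (f z) ^ 2‖ ≤ M) := by
  have hfc := hf.continuous
  have hf'c := hf.continuous_deriv le_rfl
  have hxfc : Continuous fun x : ℝ => (x : ℂ) * f x := by fun_prop
  have hxfL : MemLp (fun x : ℝ => (x : ℂ) * f x) 2 :=
    (memLp_two_iff_integrable_sq_norm hxfc.aestronglyMeasurable).2 hxf
  have hf'L : MemLp (deriv f) 2 :=
    (memLp_two_iff_integrable_sq_norm hf'c.aestronglyMeasurable).2 hf'2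
  have hprod : Integrable fun x : ℝ => 2 * (‖(x : ℂ) * f x‖ * ‖deriv f x‖) :=
    (hxfL.norm.integrable_mul hf'L.norm).const_mul 2
  have hint : Integrable fun x : ℝ => ‖f x‖ ^ 2 + 2 * (‖(x : ℂ) * f x‖ * ‖deriv f x‖) :=
    hf2.add hprod
  have hbound (z : ℝ) : ‖(z : ℂ) * f z ^ 2‖ ≤ (∫ x : ℝ, ‖f x‖ ^ 2)
      + 2 * √(∫ x : ℝ, ‖(x : ℂ) * f x‖ ^ 2) * √(∫ x : ℝ, ‖deriv f x‖ ^ 2) := by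
    calc ‖(z : ℂ) * f z ^ 2‖
        = ‖∫ s in (0 : ℝ)..z, (f s ^ 2 + 2 * (s * f s) * deriv f s)‖ := by
          rw [integral_sq_add_two_mul_mul_deriv hf]
      _ ≤ ∫ s in Set.uIoc 0 z, ‖f s ^ 2 + 2 * (s * f s) * deriv f s‖ :=
          intervalIntegral.norm_integral_le_integral_norm_uIoc
      _ ≤ ∫ s in Set.uIoc 0 z, (‖f s‖ ^ 2 + 2 * (‖(s : ℂ) * f s‖ * ‖deriv f s‖)) := by
          refine integral_mono_of_nonneg (.of_forall fun _ => norm_nonneg _)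
            hint.integrableOn (.of_forall fun s => (norm_add_le _ _).trans_eq ?_)
          simp [mul_assoc]
      _ ≤ ∫ s : ℝ, (‖f s‖ ^ 2 + 2 * (‖(s : ℂ) * f s‖ * ‖deriv f s‖)) :=
          setIntegral_le_integral hint (.of_forall fun _ => by positivity)
      _ = (∫ s : ℝ, ‖f s‖ ^ 2) + 2 * ∫ s : ℝ, ‖(s : ℂ) * f s‖ * ‖deriv f s‖ := by
          rw [integral_add hf2 hprod, integral_const_mul]
      _ ≤ _ := by
          rw [mul_assoc]
          gcongr
          exact integral_norm_mul_norm_le_sqrt_mul_sqrt hxfL hf'L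
  exact ⟨fun z => by simpa using hbound z, _, hbound⟩
end
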